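/- With h₀ := 4ξ₂ − 2ξ₃ − 2ξ₄ and h₁ := 2ξ₃ − 2ξ₄, the following identities hold at every point of ℍ: E4 = h₀² + 3·h₁² and E6 = h₀³ − 9·h₀·h₁². -/

import Mathlib

open Complex

noncomputable section

/-- `q = e^{2πiτ}`. -/
def qexp (τ : ℂ) : ℂ := Complex.exp (2 * ↑Real.pi * Complex.I * τ)

/-- `q^s = e^{2πisτ}` for real `s`. -/
def qpow (s : ℝ) (τ : ℂ) : ℂ := Complex.exp (2 * ↑Real.pi * Complex.I * ↑s * τ)

/-- The differential operator `f' = (1/(2πi)) df/dτ` (i.e. `q d/dq`). -/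
def Dq (f : ℂ → ℂ) : ℂ → ℂ := fun τ => deriv f τ / (2 * ↑Real.pi * Complex.I)

/-- The divisor power sum `σ_k(n)`. -/
def sigma' (k n : ℕ) : ℕ := ∑ d ∈ n.divisors, d ^ k

/-- The quasimodular Eisenstein series `E₂`. -/
def E2 (τ : ℂ) : ℂ := 1 - 24 * ∑' n : ℕ, (sigma' 1 (n + 1) : ℂ) * qexp τ ^ (n + 1)

/-- The Eisenstein series `E₄`. -/
def E4 (τ : ℂ) : ℂ := 1 + 240 * ∑' n : ℕ, (sigma' 3 (n + 1) : ℂ) * qexp τ ^ (n + 1)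

/-- The Eisenstein series `E₆`. -/
def E6 (τ : ℂ) : ℂ := 1 - 504 * ∑' n : ℕ, (sigma' 5 (n + 1) : ℂ) * qexp τ ^ (n + 1)

/-- The Dedekind eta function `η(τ) = q^{1/24} ∏ (1 - qⁿ)`. -/
def η (τ : ℂ) : ℂ := qpow (1/24) τ * ∏' n : ℕ, (1 - qexp τ ^ (n + 1))

/-- Theta constant `θ₂(τ) = Σ_{n∈ℤ} q^{(n-1/2)²/2}`. -/
def θ₂ (τ : ℂ) : ℂ := ∑' n : ℤ, qpow (((n : ℝ) - 1/2) ^ 2 / 2) τ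

/-- Theta constant `θ₃(τ) = Σ_{n∈ℤ} q^{n²/2}`. -/
def θ₃ (τ : ℂ) : ℂ := ∑' n : ℤ, qpow ((n : ℝ) ^ 2 / 2) τ

/-- Theta constant `θ₄(τ) = Σ_{n∈ℤ} (-1)ⁿ q^{n²/2}`. -/
def θ₄ (τ : ℂ) : ℂ := ∑' n : ℤ, (-1 : ℂ) ^ n * qpow ((n : ℝ) ^ 2 / 2) τ

/-- `ξ₂ = 2 θ₂'/θ₂`. -/
def ξ₂ : ℂ → ℂ := fun τ => 2 * Dq θ₂ τ / θ₂ τ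

/-- `ξ₃ = 2 θ₃'/θ₃`. -/
def ξ₃ : ℂ → ℂ := fun τ => 2 * Dq θ₃ τ / θ₃ τ

/-- `ξ₄ = 2 θ₄'/θ₄`. -/
def ξ₄ : ℂ → ℂ := fun τ => 2 * Dq θ₄ τ / θ₄ τ

/-- `h₀ = 4ξ₂ - 2ξ₃ - 2ξ₄` (equal to `η⁴ χ_{Λ₀}^{q}`). -/
def h₀ : ℂ → ℂ := fun τ => 4 * ξ₂ τ - 2 * ξ₃ τ - 2 * ξ₄ τ

/-- `h₁ = 2ξ₃ - 2ξ₄` (equal to `η⁴ χ_{Λ₁}^{q}`). -/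
def h₁ : ℂ → ℂ := fun τ => 2 * ξ₃ τ - 2 * ξ₄ τ

/-- The Serre-type derivative `∂_k f = f' - (k/12) E₂ f`. -/
def partialD (k : ℂ) (f : ℂ → ℂ) : ℂ → ℂ := fun τ => Dq f τ - k / 12 * E2 τ * f τ

end

open UpperHalfPlane MatrixGroups ModularForm Filter Topology
open scoped Manifold

/-- The neighbourhoods of `i∞` in `ℂ`. -/
local notation "I∞" => Filter.comap Complex.im Filter.atTop

section LevelOne

variable {F : ℂ → ℂ} {k : ℤ} {c : ℂ}

theorem mdifferentiable_restrict (hF : DifferentiableOn ℂ F {z | 0 < z.im}) :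
    MDiff (fun z : ℍ ↦ F z) := by
  rw [UpperHalfPlane.mdifferentiable_iff]
  refine hF.congr fun z hz ↦ ?_
  simp [ofComplex_apply_of_im_pos hz]

/-- A function on `ℂ` which is holomorphic on `ℍ`, has the transformation behaviour of a modular
form of weight `k` under the generators of `SL(2, ℤ)`, and converges at `i∞`, restricts to a
modular form. -/
theorem exists_modularForm_eq (hF : DifferentiableOn ℂ F {z | 0 < z.im})
    (hT : ∀ z : ℂ, 0 < z.im → F (z + 1) = F z)
    (hS : ∀ z : ℂ, 0 < z.im → F (-1 / z) = z ^ k * F z)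
    (hc : Tendsto F I∞ (𝓝 c)) :
    ∃ f : ModularForm 𝒮ℒ k, (∀ z : ℍ, f z = F z) ∧ (qExpansion 1 f).coeff 0 = c := by
  have hlim : Tendsto (fun z : ℍ ↦ F z) atImInfty (𝓝 c) := hc.comp tendsto_coe_atImInfty
  have hslash : ∀ γ : SL(2, ℤ), (fun z : ℍ ↦ F z) ∣[k] γ = fun z : ℍ ↦ F z := by
    apply SlashInvariantForm.slash_action_generators_SL2Z
    · ext z
      rw [SL_slash_apply, modular_S_smul, ModularGroup.denom_S]
      have := hS z z.im_pos
      rw [neg_div, one_div, neg_inv] at this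
      change F (-(z : ℂ))⁻¹ * _ = _
      rw [this, mul_right_comm, ← zpow_add₀ (UpperHalfPlane.ne_zero z)]
      simp
    · ext z
      rw [SL_slash_apply, modular_T_smul]
      have := hT z z.im_pos
      have hden : denom (ModularGroup.T : SL(2, ℤ)) z = 1 := by
        simp [denom, ModularGroup.coe_T]
      simp [hden, add_comm, this]
  let f : ModularForm 𝒮ℒ k :=
    { toFun := fun z ↦ F z
      slash_action_eq' := fun _ ⟨γ, hγ⟩ ↦ hγ ▸ hslash γ
      holo' := mdifferentiable_restrict hF
      bdd_at_cusps' := fun {c} hc ↦ by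
        rw [Subgroup.IsArithmetic.isCusp_iff_isCusp_SL2Z] at hc
        rw [OnePoint.isBoundedAt_iff_forall_SL2Z hc]
        intro γ _
        rw [hslash γ]
        exact hlim.isBigO_one ℝ }
  refine ⟨f, fun _ ↦ rfl, ?_⟩
  rw [UpperHalfPlane.qExpansion_coeff_zero one_pos
      (ModularFormClass.analyticAt_cuspFunction_zero f one_pos one_mem_strictPeriods_SL)
      (SlashInvariantFormClass.periodic_comp_ofComplex f one_mem_strictPeriods_SL)]
  exact hlim.limUnder_eq

theorem eq_of_qExpansion_coeff_zero_eq (hk : k < 12) (f g : ModularForm 𝒮ℒ k)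
    (h : (qExpansion 1 f).coeff 0 = (qExpansion 1 g).coeff 0) : f = g := by
  have h0 : (qExpansion 1 (f - g)).coeff 0 = 0 := by
    rw [ModularForm.qExpansion_sub one_pos one_mem_strictPeriods_SL, map_sub, h, sub_self]
  have := rank_zero_iff_forall_zero.mp (CuspForm.rank_eq_zero_of_weight_lt_twelve hk)
    (toCuspForm (f - g) h0)
  rw [← sub_eq_zero]
  ext z
  simpa using DFunLike.congr_fun this z

theorem eq_eisensteinSeries_of_tendsto_one {k : ℕ} (hk : 3 ≤ k) (hk2 : Even k) (hk' : k < 12)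
    (hF : DifferentiableOn ℂ F {z | 0 < z.im})
    (hT : ∀ z : ℂ, 0 < z.im → F (z + 1) = F z)
    (hS : ∀ z : ℂ, 0 < z.im → F (-1 / z) = z ^ k * F z)
    (hc : Tendsto F I∞ (𝓝 1)) (z : ℍ) : F z = ModularForm.E hk z := by
  obtain ⟨f, hf, hf0⟩ := exists_modularForm_eq (k := k) hF hT (by simpa using hS) hc
  rw [← hf, eq_of_qExpansion_coeff_zero_eq (by exact_mod_cast hk') f (ModularForm.E hk)]
  rw [hf0, EisensteinSeries.E_qExpansion_coeff_zero hk hk2]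

theorem ne_zero_of_weight_twelve (hF : DifferentiableOn ℂ F {z | 0 < z.im})
    (hT : ∀ z : ℂ, 0 < z.im → F (z + 1) = F z)
    (hS : ∀ z : ℂ, 0 < z.im → F (-1 / z) = z ^ 12 * F z)
    (hc : Tendsto F I∞ (𝓝 0)) (hne : ∃ z : ℂ, 0 < z.im ∧ F z ≠ 0) {z : ℂ} (hz : 0 < z.im) :
    F z ≠ 0 := by
  obtain ⟨f, hf, hf0⟩ := exists_modularForm_eq (k := 12) hF hT (by simpa using hS) hc
  obtain ⟨c, hc⟩ := CuspForm.exists_smul_discriminant_of_weight_eq_twelve (toCuspForm f hf0)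
  have key (w : ℍ) : F w = c * ModularForm.discriminant w := by
    simpa [hf] using (DFunLike.congr_fun hc w).symm
  obtain ⟨w, hw, hw0⟩ := hne
  have hc0 : c ≠ 0 := by
    rintro rfl
    exact hw0 (by simpa using key ⟨w, hw⟩)
  have := key ⟨z, hz⟩
  rw [coe_mk] at this
  rw [this]
  exact mul_ne_zero hc0 (discriminant_ne_zero _)

end LevelOne

theorem tsum_sigma'_eq (k : ℕ) (z : ℍ) :
    ∑' n : ℕ, (sigma' k (n + 1) : ℂ) * qexp z ^ (n + 1) =
      ∑' n : ℕ+, ArithmeticFunction.sigma k n * cexp (2 * Real.pi * Complex.I * z) ^ (n : ℤ) := by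
  rw [← tsum_pnat_eq_tsum_succ (f := fun n ↦ (sigma' k n : ℂ) * qexp z ^ n)]
  simp [sigma', qexp, ArithmeticFunction.sigma_apply]

theorem E4_eq_eisensteinSeries (z : ℍ) : E4 z = ModularForm.E (k := 4) (by norm_num) z := by
  rw [EisensteinSeries.q_expansion_bernoulli (by norm_num) (by decide), E4, tsum_sigma'_eq,
    bernoulli_eq_bernoulli'_of_ne_one (by norm_num), bernoulli'_four]
  norm_num

theorem E6_eq_eisensteinSeries (z : ℍ) : E6 z = ModularForm.E (k := 6) (by norm_num) z := by
  have h6 : bernoulli 6 = 1 / 42 := by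
    have h5 : bernoulli' 5 = 0 := bernoulli'_eq_zero_of_odd (by decide) (by norm_num)
    have hc : Nat.choose 6 2 = 15 := by decide
    have hc' : Nat.choose 6 4 = 15 := by decide
    rw [bernoulli_eq_bernoulli'_of_ne_one (by norm_num), bernoulli'_def]
    norm_num [Finset.sum_range_succ, h5, hc, hc', bernoulli'_four]
  rw [EisensteinSeries.q_expansion_bernoulli (by norm_num) (by decide), E6, tsum_sigma'_eq, h6]
  norm_num

section Theta

variable {τ : ℂ}

theorem θ₃_eq (τ : ℂ) : θ₃ τ = jacobiTheta₂ 0 τ := by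
  refine tsum_congr fun n ↦ ?_
  rw [qpow, jacobiTheta₂_term]
  push_cast
  ring_nf

theorem θ₄_eq (τ : ℂ) : θ₄ τ = jacobiTheta₂ (1 / 2) τ := by
  refine tsum_congr fun n ↦ ?_
  rw [qpow, jacobiTheta₂_term, ← Complex.exp_pi_mul_I, ← Complex.exp_int_mul, ← Complex.exp_add]
  push_cast
  ring_nf

theorem θ₂_eq (τ : ℂ) :
    θ₂ τ = cexp (Real.pi * Complex.I * τ / 4) * jacobiTheta₂ (-τ / 2) τ := by
  rw [jacobiTheta₂, ← tsum_mul_left]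
  refine tsum_congr fun n ↦ ?_
  rw [qpow, jacobiTheta₂_term, ← Complex.exp_add]
  push_cast
  ring_nf

theorem differentiableAt_θ₃ (hτ : 0 < τ.im) : DifferentiableAt ℂ θ₃ τ := by
  rw [funext θ₃_eq]
  exact differentiableAt_jacobiTheta₂_snd 0 hτ

theorem differentiableAt_θ₄ (hτ : 0 < τ.im) : DifferentiableAt ℂ θ₄ τ := by
  rw [funext θ₄_eq]
  exact differentiableAt_jacobiTheta₂_snd _ hτ

theorem differentiableAt_jacobiTheta₂_neg_half (hτ : 0 < τ.im) :
    DifferentiableAt ℂ (fun z ↦ jacobiTheta₂ (-z / 2) z) τ :=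
  (hasFDerivAt_jacobiTheta₂ (-τ / 2) hτ).differentiableAt.comp (f := fun z : ℂ ↦ (-z / 2, z)) τ
    (by fun_prop)

theorem differentiableAt_θ₂ (hτ : 0 < τ.im) : DifferentiableAt ℂ θ₂ τ := by
  rw [funext θ₂_eq]
  have := differentiableAt_jacobiTheta₂_neg_half hτ
  fun_prop

theorem exp_pi_mul_I_mul_sq (n : ℤ) : cexp (Real.pi * Complex.I * n ^ 2) = (-1) ^ n := by
  have h : (Real.pi * Complex.I * n ^ 2 : ℂ) = (n ^ 2 : ℤ) * (Real.pi * Complex.I) := by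
    push_cast; ring
  rw [h, Complex.exp_int_mul, Complex.exp_pi_mul_I]
  rcases Int.even_or_odd n with hn | hn
  · rw [hn.neg_one_zpow, (hn.pow_of_ne_zero two_ne_zero).neg_one_zpow]
  · rw [hn.neg_one_zpow, hn.pow.neg_one_zpow]

theorem θ₃_add_one (τ : ℂ) : θ₃ (τ + 1) = θ₄ τ := by
  refine tsum_congr fun n ↦ ?_
  rw [← exp_pi_mul_I_mul_sq, qpow, qpow, ← Complex.exp_add]
  push_cast
  ring_nf

theorem θ₄_add_one (τ : ℂ) : θ₄ (τ + 1) = θ₃ τ := by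
  rw [← θ₃_add_one, θ₃_eq, θ₃_eq, add_assoc, one_add_one_eq_two, jacobiTheta₂_add_right]

theorem θ₂_add_one (τ : ℂ) : θ₂ (τ + 1) = cexp (Real.pi * Complex.I / 4) * θ₂ τ := by
  rw [θ₂, θ₂, ← tsum_mul_left]
  refine tsum_congr fun n ↦ ?_
  have h : cexp (Real.pi * Complex.I * (n ^ 2 - n)) = 1 := by
    rw [mul_sub, Complex.exp_sub, exp_pi_mul_I_mul_sq, mul_comm _ (n : ℂ), Complex.exp_int_mul,
      Complex.exp_pi_mul_I, div_self (zpow_ne_zero _ (by norm_num))]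
  rw [qpow, qpow, ← Complex.exp_add, ← mul_one (cexp (_ + _))]
  conv_rhs => rw [← h, ← Complex.exp_add]
  push_cast
  ring_nf

theorem neg_one_div_im_pos (hτ : 0 < τ.im) : 0 < (-1 / τ).im := by
  have := UpperHalfPlane.im_inv_neg_coe_pos ⟨τ, hτ⟩
  rwa [← neg_inv, ← one_div, ← neg_div] at this

theorem neg_I_mul_mem_slitPlane (hτ : 0 < τ.im) : -Complex.I * τ ∈ slitPlane := by
  left
  simpa using hτ

theorem cpow_half_ne_zero (hτ : 0 < τ.im) : (-Complex.I * τ) ^ (1 / 2 : ℂ) ≠ 0 :=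
  fun h ↦ slitPlane_ne_zero (neg_I_mul_mem_slitPlane hτ) ((Complex.cpow_eq_zero_iff _ _).mp h).1

theorem θ₃_neg_one_div (hτ : 0 < τ.im) :
    θ₃ (-1 / τ) = (-Complex.I * τ) ^ (1 / 2 : ℂ) * θ₃ τ := by
  rw [θ₃_eq, θ₃_eq, jacobiTheta₂_functional_equation 0 τ]
  rw [← mul_assoc, ← mul_assoc, mul_one_div_cancel (cpow_half_ne_zero hτ)]
  simp

theorem θ₂_neg_one_div (hτ : 0 < τ.im) :
    θ₂ (-1 / τ) = (-Complex.I * τ) ^ (1 / 2 : ℂ) * θ₄ τ := by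
  have h0 := cpow_half_ne_zero hτ
  have hτ0 : τ ≠ 0 := by rintro rfl; simp at hτ
  rw [θ₂_eq, θ₄_eq, jacobiTheta₂_functional_equation (1 / 2) τ, ← mul_assoc, ← mul_assoc,
    mul_one_div_cancel h0, one_mul]
  congr 2 <;> field_simp
  norm_num

theorem θ₄_neg_one_div (hτ : 0 < τ.im) :
    θ₄ (-1 / τ) = (-Complex.I * τ) ^ (1 / 2 : ℂ) * θ₂ τ := by
  have h0 := cpow_half_ne_zero hτ
  have hτ0 : τ ≠ 0 := by rintro rfl; simp at hτ
  have h1 : -τ / 2 / τ = -(1 / 2) := by field_simp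
  have h2 : Real.pi * Complex.I * τ / 4 + -Real.pi * Complex.I * (-τ / 2) ^ 2 / τ = 0 := by
    field_simp; ring
  rw [θ₂_eq, θ₄_eq, jacobiTheta₂_functional_equation (-τ / 2) τ, h1, jacobiTheta₂_neg_left]
  calc _ = ((-Complex.I * τ) ^ (1 / 2 : ℂ) * (1 / (-Complex.I * τ) ^ (1 / 2 : ℂ))) *
        1 * jacobiTheta₂ (1 / 2) (-1 / τ) := by rw [mul_one_div_cancel h0]; ring
    _ = _ := by rw [← Complex.exp_zero, ← h2, Complex.exp_add]; ring

theorem eventually_im_pos : ∀ᶠ z : ℂ in I∞, 0 < z.im :=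
  tendsto_comap.eventually (eventually_gt_atTop 0)

theorem tendsto_add_one_comap_im : Tendsto (fun z : ℂ ↦ z + 1) I∞ I∞ := by
  rw [tendsto_comap_iff]
  exact tendsto_comap.congr fun z ↦ by simp

theorem tendsto_θ₃ : Tendsto θ₃ I∞ (𝓝 1) := by
  rw [tendsto_iff_norm_sub_tendsto_zero, ← tendsto_zero_iff_norm_tendsto_zero]
  have h : (fun z ↦ θ₃ z - 1) = fun z ↦ jacobiTheta z - 1 := by
    ext z
    rw [θ₃_eq, jacobiTheta_eq_jacobiTheta₂]
  rw [h]
  refine isBigO_at_im_infty_jacobiTheta_sub_one.trans_tendsto ?_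
  refine Real.tendsto_exp_atBot.comp ?_
  exact tendsto_comap.const_mul_atTop_of_neg (neg_lt_zero.mpr Real.pi_pos)

theorem tendsto_θ₄ : Tendsto θ₄ I∞ (𝓝 1) :=
  (tendsto_θ₃.comp tendsto_add_one_comap_im).congr fun z ↦ θ₃_add_one z

theorem norm_jacobiTheta₂_term_neg_half (n : ℤ) (z : ℂ) :
    ‖jacobiTheta₂_term n (-z / 2) z‖ = Real.exp (-(Real.pi * ((n ^ 2 - n : ℤ) : ℝ)) * z.im) := by
  rw [norm_jacobiTheta₂_term]
  congr 1
  have : (-z / 2).im = -z.im / 2 := by simp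
  rw [this]
  push_cast
  ring

theorem tendsto_jacobiTheta₂_neg_half :
    Tendsto (fun z ↦ jacobiTheta₂ (-z / 2) z) I∞ (𝓝 2) := by
  have hn (n : ℤ) : 0 ≤ n ^ 2 - n := by nlinarith [Int.le_self_sq n]
  have hsum : Summable fun n : ℤ ↦ ‖jacobiTheta₂_term n (-Complex.I / 2) Complex.I‖ :=
    ((summable_jacobiTheta₂_term_iff _ _).mpr (by simp)).norm
  have hlim : ∑' n : ℤ, (if n = 0 ∨ n = 1 then (1 : ℂ) else 0) = 2 := by
    rw [tsum_eq_sum (s := {0, 1})]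
    · rw [Finset.sum_pair zero_ne_one]
      norm_num
    · intro n hn
      simpa using hn
  suffices h : Tendsto (fun z ↦ jacobiTheta₂ (-z / 2) z) I∞
      (𝓝 (∑' n : ℤ, (if n = 0 ∨ n = 1 then (1 : ℂ) else 0))) by rwa [hlim] at h
  refine tendsto_tsum_of_dominated_convergence hsum (fun n ↦ ?_) ?_
  · split_ifs with h
    · refine tendsto_const_nhds.congr fun z ↦ ?_
      rw [jacobiTheta₂_term]
      rcases h with rfl | rfl
      · simp
      · rw [eq_comm, Complex.exp_eq_one_iff]
        exact ⟨0, by push_cast; ring⟩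
    · rw [tendsto_zero_iff_norm_tendsto_zero]
      simp_rw [norm_jacobiTheta₂_term_neg_half]
      refine Real.tendsto_exp_atBot.comp (tendsto_comap.const_mul_atTop_of_neg ?_)
      have h' : n ^ 2 - n ≠ 0 := by
        contrapose! h
        have : n * (n - 1) = 0 := by linarith
        rcases mul_eq_zero.mp this with h | h
        · exact Or.inl h
        · exact Or.inr (by linarith)
      have : (0 : ℝ) < (n ^ 2 - n : ℤ) := by exact_mod_cast lt_of_le_of_ne (hn n) h'.symm
      have := mul_pos Real.pi_pos this
      linarith
  · filter_upwards [tendsto_comap.eventually (eventually_ge_atTop 1)] with z hz n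
    rw [norm_jacobiTheta₂_term_neg_half, norm_jacobiTheta₂_term_neg_half]
    have : (0 : ℝ) ≤ (n ^ 2 - n : ℤ) := by exact_mod_cast hn n
    have := mul_nonneg Real.pi_pos.le this
    rw [Real.exp_le_exp, Complex.I_im]
    nlinarith

theorem tendsto_θ₂ : Tendsto θ₂ I∞ (𝓝 0) := by
  rw [funext θ₂_eq, ← zero_mul (2 : ℂ)]
  refine Tendsto.mul ?_ tendsto_jacobiTheta₂_neg_half
  rw [tendsto_zero_iff_norm_tendsto_zero]
  simp_rw [Complex.norm_exp]
  refine Real.tendsto_exp_atBot.comp ?_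
  refine (tendsto_comap.const_mul_atTop_of_neg (r := -(Real.pi / 4))
    (neg_lt_zero.mpr (by positivity))).congr fun z ↦ ?_
  simp [mul_assoc]
  ring

theorem θ_mul_ne_zero (hτ : 0 < τ.im) : (θ₂ τ * θ₃ τ * θ₄ τ) ^ 8 ≠ 0 := by
  refine ne_zero_of_weight_twelve (F := fun z ↦ (θ₂ z * θ₃ z * θ₄ z) ^ 8) ?_ ?_ ?_ ?_ ?_ hτ
  · intro z hz
    exact (((differentiableAt_θ₂ hz).mul (differentiableAt_θ₃ hz)).mul
      (differentiableAt_θ₄ hz)).pow 8 |>.differentiableWithinAt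
  · intro z _
    have h : cexp (Real.pi * Complex.I / 4) ^ 8 = 1 := by
      rw [← Complex.exp_nat_mul, Complex.exp_eq_one_iff]
      exact ⟨1, by push_cast; ring⟩
    simp only [θ₂_add_one, θ₃_add_one, θ₄_add_one]
    linear_combination (θ₂ z * θ₃ z * θ₄ z) ^ 8 * h
  · intro z hz
    have h : ((-Complex.I * z) ^ (1 / 2 : ℂ)) ^ 24 = z ^ 12 := by
      rw [← Complex.cpow_nat_mul]
      norm_num [mul_pow]
      rw [show Complex.I ^ 12 = (Complex.I ^ 4) ^ 3 by ring, Complex.I_pow_four]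
      norm_num
    simp only [θ₂_neg_one_div hz, θ₃_neg_one_div hz, θ₄_neg_one_div hz]
    linear_combination (θ₂ z * θ₃ z * θ₄ z) ^ 8 * h
  · simpa using ((tendsto_θ₂.mul tendsto_θ₃).mul tendsto_θ₄).pow 8
  · have : NeBot I∞ := comap_neBot fun t ht ↦ by
      obtain ⟨a, ha⟩ := nonempty_of_mem ht
      exact ⟨a * Complex.I, by simpa using ha⟩
    obtain ⟨z, hz, h₂, h₃, h₄⟩ := (eventually_im_pos.and
      ((tendsto_jacobiTheta₂_neg_half.eventually_ne two_ne_zero).and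
      ((tendsto_θ₃.eventually_ne one_ne_zero).and
      (tendsto_θ₄.eventually_ne one_ne_zero)))).exists
    refine ⟨z, hz, pow_ne_zero _ (mul_ne_zero (mul_ne_zero ?_ h₃) h₄)⟩
    rw [θ₂_eq]
    exact mul_ne_zero (Complex.exp_ne_zero _) h₂

theorem θ₂_ne_zero (hτ : 0 < τ.im) : θ₂ τ ≠ 0 := fun h ↦ θ_mul_ne_zero hτ (by simp [h])

theorem θ₃_ne_zero (hτ : 0 < τ.im) : θ₃ τ ≠ 0 := fun h ↦ θ_mul_ne_zero hτ (by simp [h])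

theorem θ₄_ne_zero (hτ : 0 < τ.im) : θ₄ τ ≠ 0 := fun h ↦ θ_mul_ne_zero hτ (by simp [h])

end Theta

section LogDeriv

variable {f g s : ℂ → ℂ} {τ c : ℂ}

theorem tendsto_deriv_comap_im (hf : DifferentiableOn ℂ f {z | 0 < z.im})
    (hc : Tendsto f I∞ (𝓝 c)) : Tendsto (deriv f) I∞ (𝓝 0) := by
  rw [Metric.tendsto_nhds]
  intro ε hε
  obtain ⟨M, hM⟩ := (eventually_atTop.mp
    (eventually_comap.mp (Metric.tendsto_nhds.mp hc (ε / 2) (by positivity))))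
  filter_upwards [tendsto_comap.eventually (eventually_gt_atTop (max M 0 + 1))] with z hz
  have him {w : ℂ} (hw : w ∈ Metric.closedBall z 1) : max M 0 < w.im := by
    have h1 := (Complex.abs_im_le_norm (w - z)).trans (mem_closedBall_iff_norm.mp hw)
    have h2 := (abs_le.mp h1).1
    rw [Complex.sub_im] at h2
    linarith
  have hd : DiffContOnCl ℂ (fun w ↦ f w - c) (Metric.ball z 1) := by
    refine DifferentiableOn.diffContOnCl_ball (U := {z | 0 < z.im}) (hf.sub_const c) fun w hw ↦ ?_
    exact (le_max_right M 0).trans_lt (him hw)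
  have := Complex.norm_deriv_le_of_forall_mem_sphere_norm_le one_pos hd (C := ε / 2) fun w hw ↦ by
    rw [← dist_eq_norm]
    exact (hM _ ((le_max_left M 0).trans (him (Metric.sphere_subset_closedBall hw)).le) w rfl).le
  rw [deriv_sub_const] at this
  rw [dist_zero_right]
  linarith

theorem tendsto_logDeriv_comap_im (hf : DifferentiableOn ℂ f {z | 0 < z.im})
    (hc : Tendsto f I∞ (𝓝 c)) (hc0 : c ≠ 0) : Tendsto (logDeriv f) I∞ (𝓝 0) := by
  have h := (tendsto_deriv_comap_im hf hc).div hc hc0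
  rw [zero_div] at h
  exact h

theorem logDeriv_add_one (hc : c ≠ 0) (h : ∀ z, f (z + 1) = c * g z) :
    logDeriv f (τ + 1) = logDeriv g τ := by
  rw [logDeriv_apply, ← deriv_comp_add_const, h, funext h, deriv_const_mul_field, logDeriv_apply,
    mul_div_mul_left _ _ hc]

theorem logDeriv_neg_one_div (h : ∀ z : ℂ, 0 < z.im → f (-1 / z) = s z * g z) (hτ : 0 < τ.im)
    (hf : DifferentiableAt ℂ f (-1 / τ)) (hs : DifferentiableAt ℂ s τ)
    (hg : DifferentiableAt ℂ g τ) (hs0 : s τ ≠ 0) (hg0 : g τ ≠ 0) :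
    logDeriv f (-1 / τ) = τ ^ 2 * (logDeriv s τ + logDeriv g τ) := by
  have hτ0 : τ ≠ 0 := by rintro rfl; simp at hτ
  have hd : HasDerivAt (fun z : ℂ ↦ -1 / z) (1 / τ ^ 2) τ := by
    exact ((hasDerivAt_const τ (-1 : ℂ)).div (hasDerivAt_id τ) hτ0).congr_deriv (by simp)
  rw [← logDeriv_mul _ hs0 hg0 hs hg]
  have hev : f ∘ (fun z ↦ -1 / z) =ᶠ[𝓝 τ] fun z ↦ s z * g z := by
    filter_upwards [isOpen_upperHalfPlaneSet.mem_nhds hτ] with z hz using h z hz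
  have h1 : logDeriv (f ∘ fun z ↦ -1 / z) τ = logDeriv (fun z ↦ s z * g z) τ := by
    rw [logDeriv_apply, logDeriv_apply, hev.deriv_eq, hev.eq_of_nhds]
  rw [← h1, logDeriv_comp hf hd.differentiableAt, hd.deriv]
  field_simp

end LogDeriv

section Characters

variable {τ : ℂ}

theorem h₀_eq (τ : ℂ) : h₀ τ = (Real.pi * Complex.I)⁻¹ *
    (4 * logDeriv θ₂ τ - 2 * logDeriv θ₃ τ - 2 * logDeriv θ₄ τ) := by
  simp only [h₀, ξ₂, ξ₃, ξ₄, Dq, logDeriv_apply]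
  field_simp

theorem h₁_eq (τ : ℂ) : h₁ τ = (Real.pi * Complex.I)⁻¹ *
    (2 * logDeriv θ₃ τ - 2 * logDeriv θ₄ τ) := by
  simp only [h₁, ξ₃, ξ₄, Dq, logDeriv_apply]
  field_simp

theorem logDeriv_θ₂_add_one (τ : ℂ) : logDeriv θ₂ (τ + 1) = logDeriv θ₂ τ :=
  logDeriv_add_one (Complex.exp_ne_zero _) θ₂_add_one

theorem logDeriv_θ₃_add_one (τ : ℂ) : logDeriv θ₃ (τ + 1) = logDeriv θ₄ τ :=
  logDeriv_add_one one_ne_zero fun z ↦ by rw [θ₃_add_one, one_mul]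

theorem logDeriv_θ₄_add_one (τ : ℂ) : logDeriv θ₄ (τ + 1) = logDeriv θ₃ τ :=
  logDeriv_add_one one_ne_zero fun z ↦ by rw [θ₄_add_one, one_mul]

theorem h₀_add_one (τ : ℂ) : h₀ (τ + 1) = h₀ τ := by
  rw [h₀_eq, h₀_eq, logDeriv_θ₂_add_one, logDeriv_θ₃_add_one, logDeriv_θ₄_add_one]
  ring

theorem h₁_add_one (τ : ℂ) : h₁ (τ + 1) = -h₁ τ := by
  rw [h₁_eq, h₁_eq, logDeriv_θ₃_add_one, logDeriv_θ₄_add_one]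
  ring

theorem h₀_h₁_neg_one_div (hτ : 0 < τ.im) :
    h₀ (-1 / τ) = -τ ^ 2 * (h₀ τ + 3 * h₁ τ) / 2 ∧
      h₁ (-1 / τ) = τ ^ 2 * (h₁ τ - h₀ τ) / 2 := by
  have hτ' := neg_one_div_im_pos hτ
  have hs0 := cpow_half_ne_zero hτ
  have hs : DifferentiableAt ℂ (fun z : ℂ ↦ (-Complex.I * z) ^ (1 / 2 : ℂ)) τ :=
    DifferentiableAt.cpow_const (by fun_prop) (neg_I_mul_mem_slitPlane hτ)
  have h₂ := logDeriv_neg_one_div (fun _ ↦ θ₂_neg_one_div) hτ (differentiableAt_θ₂ hτ') hs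
    (differentiableAt_θ₄ hτ) hs0 (θ₄_ne_zero hτ)
  have h₃ := logDeriv_neg_one_div (fun _ ↦ θ₃_neg_one_div) hτ (differentiableAt_θ₃ hτ') hs
    (differentiableAt_θ₃ hτ) hs0 (θ₃_ne_zero hτ)
  have h₄ := logDeriv_neg_one_div (fun _ ↦ θ₄_neg_one_div) hτ (differentiableAt_θ₄ hτ') hs
    (differentiableAt_θ₂ hτ) hs0 (θ₂_ne_zero hτ)
  constructor
  · rw [h₀_eq, h₀_eq, h₁_eq, h₂, h₃, h₄]
    ring
  · rw [h₁_eq, h₀_eq, h₁_eq, h₃, h₄]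
    ring

theorem differentiableOn_logDeriv {f : ℂ → ℂ} (hf : ∀ z : ℂ, 0 < z.im → DifferentiableAt ℂ f z)
    (hf0 : ∀ z : ℂ, 0 < z.im → f z ≠ 0) : DifferentiableOn ℂ (logDeriv f) {z | 0 < z.im} := by
  have h : DifferentiableOn ℂ f {z | 0 < z.im} := fun z hz ↦ (hf z hz).differentiableWithinAt
  exact (h.deriv isOpen_upperHalfPlaneSet).div h hf0

theorem differentiableOn_h₀ : DifferentiableOn ℂ h₀ {z | 0 < z.im} := by
  have h₂ := differentiableOn_logDeriv (fun _ ↦ differentiableAt_θ₂) (fun _ ↦ θ₂_ne_zero)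
  have h₃ := differentiableOn_logDeriv (fun _ ↦ differentiableAt_θ₃) (fun _ ↦ θ₃_ne_zero)
  have h₄ := differentiableOn_logDeriv (fun _ ↦ differentiableAt_θ₄) (fun _ ↦ θ₄_ne_zero)
  rw [funext h₀_eq]
  fun_prop

theorem differentiableOn_h₁ : DifferentiableOn ℂ h₁ {z | 0 < z.im} := by
  have h₃ := differentiableOn_logDeriv (fun _ ↦ differentiableAt_θ₃) (fun _ ↦ θ₃_ne_zero)
  have h₄ := differentiableOn_logDeriv (fun _ ↦ differentiableAt_θ₄) (fun _ ↦ θ₄_ne_zero)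
  rw [funext h₁_eq]
  fun_prop

theorem tendsto_logDeriv_θ₃ : Tendsto (logDeriv θ₃) I∞ (𝓝 0) :=
  tendsto_logDeriv_comap_im (fun _ hz ↦ (differentiableAt_θ₃ hz).differentiableWithinAt)
    tendsto_θ₃ one_ne_zero

theorem tendsto_logDeriv_θ₄ : Tendsto (logDeriv θ₄) I∞ (𝓝 0) :=
  tendsto_logDeriv_comap_im (fun _ hz ↦ (differentiableAt_θ₄ hz).differentiableWithinAt)
    tendsto_θ₄ one_ne_zero

theorem tendsto_logDeriv_θ₂ : Tendsto (logDeriv θ₂) I∞ (𝓝 (Real.pi * Complex.I / 4)) := by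
  have h := tendsto_logDeriv_comap_im
    (fun _ hz ↦ (differentiableAt_jacobiTheta₂_neg_half hz).differentiableWithinAt)
    tendsto_jacobiTheta₂_neg_half two_ne_zero
  rw [← add_zero (Real.pi * Complex.I / 4 : ℂ)]
  refine (h.const_add _).congr' ?_
  filter_upwards [eventually_im_pos,
    tendsto_jacobiTheta₂_neg_half.eventually_ne two_ne_zero] with z hz hz0
  have hexp : HasDerivAt (fun w : ℂ ↦ cexp (Real.pi * Complex.I * w / 4))
      (cexp (Real.pi * Complex.I * z / 4) * (Real.pi * Complex.I * 1 / 4)) z :=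
    (((hasDerivAt_id z).const_mul _).div_const _).cexp
  rw [funext θ₂_eq, logDeriv_mul (f := fun w : ℂ ↦ cexp (Real.pi * Complex.I * w / 4))
    (g := fun w ↦ jacobiTheta₂ (-w / 2) w) z (Complex.exp_ne_zero _) hz0 hexp.differentiableAt
    (differentiableAt_jacobiTheta₂_neg_half hz),
    logDeriv_apply (fun w : ℂ ↦ cexp (Real.pi * Complex.I * w / 4)), hexp.deriv,
    mul_div_cancel_left₀ _ (Complex.exp_ne_zero _), mul_one]

theorem tendsto_h₀ : Tendsto h₀ I∞ (𝓝 1) := by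
  have := (((tendsto_logDeriv_θ₂.const_mul 4).sub (tendsto_logDeriv_θ₃.const_mul 2)).sub
    (tendsto_logDeriv_θ₄.const_mul 2)).const_mul (Real.pi * Complex.I : ℂ)⁻¹
  rw [funext h₀_eq]
  convert this using 2
  have : (Real.pi : ℂ) ≠ 0 := by exact_mod_cast Real.pi_ne_zero
  field_simp
  simp

theorem tendsto_h₁ : Tendsto h₁ I∞ (𝓝 0) := by
  rw [funext h₁_eq]
  simpa using ((tendsto_logDeriv_θ₃.const_mul 2).sub
    (tendsto_logDeriv_θ₄.const_mul 2)).const_mul (Real.pi * Complex.I : ℂ)⁻¹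

end Characters

/-- `E₄ = h₀² + 3h₁²` and `E₆ = h₀³ - 9h₀h₁²` on `ℍ`. -/
theorem E4_E6_in_terms_of_characters (τ : ℂ) (hτ : 0 < τ.im) :
    E4 τ = h₀ τ ^ 2 + 3 * h₁ τ ^ 2 ∧
    E6 τ = h₀ τ ^ 3 - 9 * h₀ τ * h₁ τ ^ 2 := by
  have d₀ := differentiableOn_h₀
  have d₁ := differentiableOn_h₁
  constructor
  · refine (E4_eq_eisensteinSeries ⟨τ, hτ⟩).trans (eq_eisensteinSeries_of_tendsto_one
      (F := fun z ↦ h₀ z ^ 2 + 3 * h₁ z ^ 2) (by norm_num) (by decide) (by norm_num)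
      (by fun_prop) (fun z _ ↦ ?_) (fun z hz ↦ ?_) ?_ ⟨τ, hτ⟩).symm
    · simp only [h₀_add_one, h₁_add_one]
      ring
    · simp only [h₀_h₁_neg_one_div hz]
      ring
    · simpa using (tendsto_h₀.pow 2).add ((tendsto_h₁.pow 2).const_mul 3)
  · refine (E6_eq_eisensteinSeries ⟨τ, hτ⟩).trans (eq_eisensteinSeries_of_tendsto_one
      (F := fun z ↦ h₀ z ^ 3 - 9 * h₀ z * h₁ z ^ 2) (by norm_num) (by decide) (by norm_num)
      (by fun_prop) (fun z _ ↦ ?_) (fun z hz ↦ ?_) ?_ ⟨τ, hτ⟩).symm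
    · simp only [h₀_add_one, h₁_add_one]
      ring
    · simp only [h₀_h₁_neg_one_div hz]
      ring
    · simpa using (tendsto_h₀.pow 3).sub ((tendsto_h₀.const_mul 9).mul (tendsto_h₁.pow 2))
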